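/- arXiv:2012.02187 — 2 statements merged into one kernel-verified Lean document; each statement's English description precedes it below -/
import Mathlib

section
/- Define, for $\tau \in \mathfrak{gl}_{n+1}(\mathbb{C})$, the $n\times n$ matrix $D(\tau)$ with entries $D(\tau)_{ij} = \mathrm{tr}([1_H,[\tau^i, \tau_H^{j-1}]]\,\tau)$ for $1 \le i,j \le n$, where $1_H=\mathrm{diag}(1,\dots,1,0)$, $\tau_H = 1_H\tau 1_H$ and $\tau_H^{j-1} := 1_H(\tau_H)^{j-1}$. Then $\det D(\tau) = 2^n(-1)^{n(n-1)/2}\prod_{i=1}^{n+1}\prod_{j=1}^{n}(\lambda_i - \mu_j)$, where $\lambda_1,\dots,\lambda_{n+1}$ are the eigenvalues of $\tau$ and $\mu_1,\dots,\mu_n, 0$ are the eigenvalues of $\tau_H$ (as an $(n+1)\times(n+1)$ matrix). -/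
open Matrix Polynomial

/-- `1_H = diag(1,…,1,0)` as an `(n+1) × (n+1)` complex matrix. -/
noncomputable def oneHmat (n : ℕ) : Matrix (Fin (n + 1)) (Fin (n + 1)) ℂ :=
  Matrix.diagonal fun i => if i = Fin.last n then 0 else 1

/-- `τ_H := 1_H τ 1_H`, as an `(n+1) × (n+1)` matrix. -/
noncomputable def tauHmat (n : ℕ) (τ : Matrix (Fin (n + 1)) (Fin (n + 1)) ℂ) :
    Matrix (Fin (n + 1)) (Fin (n + 1)) ℂ :=
  oneHmat n * τ * oneHmat n

/-- The `n × n` matrix `D(τ)` with (1-based) entries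
`D(τ)_{ij} = tr([1_H, [τ^i, τ_H^{j-1}]] τ)`, where `τ_H^{j-1} := 1_H (τ_H)^{j-1}`
(so that the zeroth power is `1_H`) and `[a,b] = ab - ba`. -/
noncomputable def Dmat (n : ℕ) (τ : Matrix (Fin (n + 1)) (Fin (n + 1)) ℂ) :
    Matrix (Fin n) (Fin n) ℂ :=
  Matrix.of fun i j : Fin n =>
    Matrix.trace
      ((oneHmat n *
            (τ ^ ((i : ℕ) + 1) * (oneHmat n * tauHmat n τ ^ (j : ℕ)) -
              (oneHmat n * tauHmat n τ ^ (j : ℕ)) * τ ^ ((i : ℕ) + 1)) -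
          (τ ^ ((i : ℕ) + 1) * (oneHmat n * tauHmat n τ ^ (j : ℕ)) -
              (oneHmat n * tauHmat n τ ^ (j : ℕ)) * τ ^ ((i : ℕ) + 1)) * oneHmat n) * τ)


theorem aux_tri_det (n : ℕ) : ∀ f : ℕ → ℂ, f n = 1 → (∀ m, n < m → f m = 0) →
    (Matrix.of fun k l : Fin n => f ((k : ℕ) + l + 1)).det = (-1 : ℂ) ^ (n * (n - 1) / 2) := by
  induction n with
  | zero => intro f _ _; simp
  | succ n ih =>
    intro f h1 h0
    rw [Matrix.det_succ_row _ (Fin.last n), Finset.sum_eq_single 0]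
    · have := ih (fun m => f (m + 1)) h1 (fun m hm => h0 _ (by omega))
      have e : ((Matrix.of fun k l : Fin (n+1) => f ((k : ℕ) + l + 1)).submatrix
          (Fin.last n).succAbove (Fin.succAbove 0)) =
          (Matrix.of fun k l : Fin n => f ((k : ℕ) + l + 1 + 1)) := by
        ext k l
        simp [add_assoc]
      rw [e, this]
      have e2 : (n + 1) * (n + 1 - 1) / 2 = n + n * (n - 1) / 2 := by
        rcases n with _ | n
        · simp
        · have : (n + 1 + 1) * (n + 1 + 1 - 1) = (n + 1) * (n + 1 - 1) + (n+1) * 2 := by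
            simp only [Nat.add_sub_cancel]; ring
          rw [this, Nat.add_mul_div_right _ _ (by norm_num)]
          ring
      rw [e2]
      simp [h1, pow_add]
    · intro l _ hl
      have : 0 < (l : ℕ) := Nat.pos_of_ne_zero (fun h => hl (Fin.ext h))
      simp [h0 (n + l + 1) (by omega)]
    · simp

theorem aux_tele {M : Type*} [AddCommGroup M] (n : ℕ) (F : ℕ → ℕ → M)
    (hF : ∀ k l, n < k + l → F k l = 0) :
    ∑ k ∈ Finset.range n, ∑ l ∈ Finset.range n, (F (k + 1) l - F k (l + 1)) =
      ∑ k ∈ Finset.range (n + 1), F k 0 - ∑ l ∈ Finset.range (n + 1), F 0 l := by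
  rcases n with _ | n
  · simp
  have h1 : ∀ l, ∑ k ∈ Finset.range (n + 1), F (k + 1) l =
      ∑ k ∈ Finset.range (n + 1), F k l + F (n + 1) l - F 0 l := by
    intro l
    rw [← Finset.sum_range_succ, Finset.sum_range_succ' _ (n + 1)]; abel
  have h2 : ∀ k, ∑ l ∈ Finset.range (n + 1), F k (l + 1) =
      ∑ l ∈ Finset.range (n + 1), F k l + F k (n + 1) - F k 0 := by
    intro l
    rw [← Finset.sum_range_succ, Finset.sum_range_succ' _ (n + 1)]; abel
  have h3 : ∑ l ∈ Finset.range (n + 1), F (n + 1) l = F (n + 1) 0 := by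
    rw [Finset.sum_eq_single 0]
    · intro l _ hl; exact hF _ _ (by omega)
    · simp
  have h4 : ∑ k ∈ Finset.range (n + 1), F k (n + 1) = F 0 (n + 1) := by
    rw [Finset.sum_eq_single 0]
    · intro l _ hl; exact hF _ _ (by omega)
    · simp
  simp only [Finset.sum_sub_distrib]
  rw [Finset.sum_comm]
  simp only [h1, h2, Finset.sum_sub_distrib, Finset.sum_add_distrib, h3, h4]
  rw [Finset.sum_comm, Finset.sum_range_succ _ (n + 1), Finset.sum_range_succ _ (n + 1)]
  abel

noncomputable def auxG {n : ℕ} (A : Matrix (Fin n) (Fin n) ℂ) : Matrix (Fin n) (Fin n) ℂ[X] :=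
  ∑ k ∈ Finset.range n, ∑ l ∈ Finset.range n,
    (C (A.charpoly.coeff (k + l + 1)) * X ^ k) • (A ^ l).map C

theorem aux_resolvent {n : ℕ} (A : Matrix (Fin n) (Fin n) ℂ) :
    charmatrix A * auxG A = A.charpoly • (1 : Matrix (Fin n) (Fin n) ℂ[X]) := by
  have hdeg : A.charpoly.natDegree = n := by simp
  have key := aux_tele n (fun k l => (C (A.charpoly.coeff (k + l)) * X ^ k : ℂ[X]) • (A ^ l).map C)
    (by intro k l h; simp [coeff_eq_zero_of_natDegree_lt (hdeg ▸ h)])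
  have h1 : ∑ k ∈ Finset.range (n + 1), (C (A.charpoly.coeff k) * X ^ k : ℂ[X]) = A.charpoly := by
    conv_rhs => rw [A.charpoly.as_sum_range_C_mul_X_pow, hdeg]
  have h2 : ∑ l ∈ Finset.range (n + 1), (C (A.charpoly.coeff l) : ℂ[X]) • (A ^ l).map C = 0 := by
    have h := Matrix.aeval_self_charpoly A
    rw [aeval_eq_sum_range, hdeg] at h
    have h' := congrArg (fun M : Matrix (Fin n) (Fin n) ℂ => C.mapMatrix M) h
    simp only [map_sum, map_zero] at h'
    rw [← h']
    refine Finset.sum_congr rfl fun l _ => ?_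
    ext i j : 1
    simp
  have e1 : ((A ^ 0).map C : Matrix (Fin n) (Fin n) ℂ[X]) = 1 := by simp
  simp only [add_zero, zero_add, pow_zero, mul_one] at key
  rw [h2, sub_zero] at key
  rw [← pow_zero A, e1, ← Finset.sum_smul, h1] at key
  rw [← key, auxG, Finset.mul_sum]
  refine Finset.sum_congr rfl fun k _ => ?_
  rw [Finset.mul_sum]
  refine Finset.sum_congr rfl fun l _ => ?_
  have e2 : ((A ^ (l + 1)).map C : Matrix (Fin n) (Fin n) ℂ[X]) = A.map C * (A ^ l).map C := by
    rw [pow_succ', Matrix.map_mul]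
  have e3 : (charmatrix A) = (X : ℂ[X]) • 1 - A.map C := by
    ext i j : 1
    simp [charmatrix, Matrix.smul_eq_diagonal_mul]
  rw [e2, e3, Matrix.mul_smul, sub_mul, Matrix.smul_mul, one_mul, smul_sub, smul_smul]
  congr 2
  · rw [add_right_comm, pow_succ, mul_assoc]
  
theorem aux_bordered {n : ℕ} (A : Matrix (Fin n) (Fin n) ℂ) (b : Matrix (Fin n) (Fin 1) ℂ)
    (c : Matrix (Fin 1) (Fin n) ℂ) (d : Matrix (Fin 1) (Fin 1) ℂ) :
    (fromBlocks A b c d).charpoly =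
      (X - C (d 0 0)) * A.charpoly - (c.map C * auxG A * b.map C) 0 0 := by
  have h : (charmatrix (fromBlocks A b c d)) *
      fromBlocks 1 (auxG A * b.map C) 0 (A.charpoly • 1) =
      fromBlocks (charmatrix A) 0 (-(c.map C))
        (-(c.map C * auxG A * b.map C) + A.charpoly • charmatrix d) := by
    rw [charmatrix_fromBlocks, fromBlocks_multiply]
    congr 1
    · simp
    · rw [← Matrix.mul_assoc, aux_resolvent]; simp
    · simp
    · simp [Matrix.mul_assoc]
  have h' := congrArg Matrix.det h
  rw [det_mul, det_fromBlocks_zero₂₁, det_fromBlocks_zero₁₂] at h'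
  rw [det_one, one_mul] at h'
  simp only [det_fin_one] at h'
  have hne : A.charpoly ≠ 0 := A.charpoly_monic.ne_zero
  apply mul_right_cancel₀ hne
  rw [Matrix.charpoly]
  simp at h'
  rw [h']
  simp only [Matrix.charpoly]
  ring

noncomputable def auxq {n : ℕ} (A : Matrix (Fin n) (Fin n) ℂ) (b : Matrix (Fin n) (Fin 1) ℂ)
    (c : Matrix (Fin 1) (Fin n) ℂ) (j : ℕ) : ℂ[X] :=
  (c.map C * ((A ^ j).map C * (auxG A * b.map C))) 0 0

theorem auxq_expand {n : ℕ} (A : Matrix (Fin n) (Fin n) ℂ) (b : Matrix (Fin n) (Fin 1) ℂ)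
    (c : Matrix (Fin 1) (Fin n) ℂ) (j : ℕ) :
    auxq A b c j = ∑ k : Fin n, C (∑ l : Fin n, A.charpoly.coeff ((k : ℕ) + l + 1) *
      (c * A ^ ((l : ℕ) + j) * b) 0 0) * X ^ (k : ℕ) := by
  have e : ∀ l : ℕ, C ((c * A ^ (l + j) * b) 0 0) =
      (c.map C * ((A ^ j).map C * ((A ^ l).map C * b.map C)) : Matrix _ _ ℂ[X]) 0 0 := by
    intro l
    rw [← Matrix.map_mul, ← Matrix.map_mul, ← Matrix.map_mul, Matrix.map_apply,
      ← Matrix.mul_assoc (A ^ j), ← pow_add, add_comm j l, Matrix.mul_assoc]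
  unfold auxq auxG
  rw [Finset.sum_range]
  simp only [Finset.sum_range, Matrix.sum_mul, Matrix.mul_sum, Matrix.sum_apply, Matrix.smul_mul,
    Matrix.mul_smul, Matrix.smul_apply, map_sum, Finset.sum_mul, map_mul, e, smul_eq_mul]
  refine Finset.sum_congr rfl fun k _ => Finset.sum_congr rfl fun l _ => ?_
  ring

theorem auxq_rec {n : ℕ} (A : Matrix (Fin n) (Fin n) ℂ) (b : Matrix (Fin n) (Fin 1) ℂ)
    (c : Matrix (Fin 1) (Fin n) ℂ) (j : ℕ) :
    X * auxq A b c j - auxq A b c (j + 1) = A.charpoly * C ((c * A ^ j * b) 0 0) := by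
  have e3 : (charmatrix A) = (X : ℂ[X]) • 1 - A.map C := by
    ext i j : 1
    simp [charmatrix, Matrix.smul_eq_diagonal_mul]
  have h := congrArg (fun M => (c.map C * ((A ^ j).map C * (M * b.map C)) : Matrix _ _ ℂ[X]) 0 0)
    (aux_resolvent A)
  simp only [e3, sub_mul, Matrix.smul_mul, Matrix.mul_sub, Matrix.sub_mul, Matrix.mul_smul,
    Matrix.sub_apply, Matrix.smul_apply, one_mul, Matrix.one_mul, smul_eq_mul] at h
  unfold auxq
  rw [pow_succ, Matrix.map_mul, Matrix.mul_assoc ((A ^ j).map C), ← Matrix.mul_assoc (A.map C), h,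
    ← Matrix.map_mul, ← Matrix.map_mul, Matrix.map_apply, Matrix.mul_assoc]

theorem aux_hankel {n : ℕ} (A : Matrix (Fin n) (Fin n) ℂ) (b : Matrix (Fin n) (Fin 1) ℂ)
    (c : Matrix (Fin 1) (Fin n) ℂ) (d : Matrix (Fin 1) (Fin 1) ℂ)
    (lam : Fin (n + 1) → ℂ) (μ : Fin n → ℂ)
    (hlam : (fromBlocks A b c d).charpoly = ∏ i, (X - C (lam i)))
    (hμ : A.charpoly = ∏ j, (X - C (μ j))) :
    (-1 : ℂ) ^ (n * (n - 1) / 2) *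
      (Matrix.of fun k j : Fin n => (c * A ^ ((k : ℕ) + j) * b) 0 0).det =
      (-1) ^ n * ∏ i, ∏ j, (lam i - μ j) := by
  have hmon : A.charpoly.Monic := A.charpoly_monic
  have hdeg : A.charpoly.natDegree = n := by simp
  set f := A.charpoly with hf
  let pb := AdjoinRoot.powerBasis hmon.ne_zero
  have hdim : pb.dim = n := by rw [AdjoinRoot.powerBasis_dim, hdeg]
  let B : Module.Basis (Fin n) ℂ (AdjoinRoot f) := pb.basis.reindex (finCongr hdim)
  have hB : ∀ k, B k = AdjoinRoot.root f ^ (k : ℕ) := by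
    intro k
    simp [B, pb]
  -- norm of `λ - root`
  have hnorm : ∀ z : ℂ, Algebra.norm ℂ (algebraMap ℂ (AdjoinRoot f) z - AdjoinRoot.root f) =
      f.eval z := by
    intro z
    have h1 := charpoly_leftMulMatrix pb
    rw [AdjoinRoot.minpoly_powerBasis_gen_of_monic hmon] at h1
    have h2 := Matrix.eval_charpoly (Algebra.leftMulMatrix pb.basis pb.gen) z
    rw [h1] at h2
    rw [h2, Algebra.norm_eq_matrix_det pb.basis, map_sub, AlgHom.commutes]
    rfl
  let y : ℕ → AdjoinRoot f := fun j => AdjoinRoot.mk f (auxq A b c j)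
  have hyrec : ∀ j, y (j + 1) = y j * AdjoinRoot.root f := by
    intro j
    have := congrArg (AdjoinRoot.mk f) (auxq_rec A b c j)
    rw [map_sub, map_mul, map_mul, ← hf, AdjoinRoot.mk_self, zero_mul, AdjoinRoot.mk_X] at this
    rw [mul_comm]
    exact (sub_eq_zero.mp this).symm
  have hypow : ∀ j, y j = y 0 * AdjoinRoot.root f ^ j := by
    intro j
    induction j with
    | zero => simp
    | succ j ih => rw [hyrec, ih, pow_succ, mul_assoc]
  have hy0 : y 0 = (-1) ^ n * ∏ i, (algebraMap ℂ (AdjoinRoot f) (lam i) - AdjoinRoot.root f) := by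
    have h := aux_bordered A b c d
    have h' := congrArg (AdjoinRoot.mk f) h
    rw [hlam, map_sub, map_mul, ← hf, AdjoinRoot.mk_self, mul_zero, zero_sub, map_prod] at h'
    have e : y 0 = AdjoinRoot.mk f ((c.map C * auxG A * b.map C) 0 0) := by
      simp [y, auxq, Matrix.mul_assoc]
    rw [e, eq_comm, ← neg_eq_iff_eq_neg.mpr h'.symm.symm]
    have e2 : ∀ i, AdjoinRoot.mk f (X - C (lam i)) =
        (-1) * (algebraMap ℂ (AdjoinRoot f) (lam i) - AdjoinRoot.root f) := by
      intro i
      rw [map_sub, AdjoinRoot.mk_X, AdjoinRoot.mk_C, AdjoinRoot.algebraMap_eq]; ring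
    simp only [e2, Finset.prod_mul_distrib]
    simp [pow_succ]
  have hN : Algebra.norm ℂ (y 0) = (-1) ^ n * ∏ i, ∏ j, (lam i - μ j) := by
    have hm1 : Algebra.norm ℂ (-1 : AdjoinRoot f) = (-1) ^ n := by
      have := Algebra.norm_algebraMap_of_basis B (-1 : ℂ)
      simpa using this
    rw [hy0, map_mul, map_pow, hm1, map_prod]
    congr 1
    · rw [← pow_mul]
      rcases Nat.even_or_odd n with h | h
      · rw [(h.mul_right n).neg_one_pow, h.neg_one_pow]
      · rw [(h.mul h).neg_one_pow, h.neg_one_pow]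
    · refine Finset.prod_congr rfl fun i _ => ?_
      rw [hnorm, hμ, eval_prod]
      simp
  rw [← hN, Algebra.norm_eq_matrix_det B, ← aux_tri_det n f.coeff
    (by have := hmon.coeff_natDegree; rwa [hdeg] at this)
    (fun m hm => coeff_eq_zero_of_natDegree_lt (hdeg ▸ hm)), ← det_mul]
  congr 1
  ext k j
  rw [Algebra.leftMulMatrix_eq_repr_mul, hB, ← hypow]
  have e : y j = ∑ k : Fin n, (∑ l : Fin n, f.coeff ((k : ℕ) + l + 1) *
      (c * A ^ ((l : ℕ) + j) * b) 0 0) • B k := by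
    simp only [y, auxq_expand, map_sum, hB, map_mul, map_pow, AdjoinRoot.mk_X, AdjoinRoot.mk_C,
      Algebra.smul_def, AdjoinRoot.algebraMap_eq, ← hf]
  rw [e, B.repr_sum_self, Matrix.mul_apply]
  rfl

theorem aux_pow12 {n : ℕ} (A : Matrix (Fin n) (Fin n) ℂ) (b : Matrix (Fin n) (Fin 1) ℂ)
    (c : Matrix (Fin 1) (Fin n) ℂ) (d : Matrix (Fin 1) (Fin 1) ℂ) (i : ℕ) :
    (fromBlocks A b c d ^ i).toBlocks₁₂ = ∑ k ∈ Finset.range i,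
      ((fromBlocks A b c d ^ (i - 1 - k)).toBlocks₂₂ 0 0) • (A ^ k * b) := by
  induction i with
  | zero => ext; simp [toBlocks₁₂]
  | succ i ih =>
    rw [pow_succ']
    nth_rewrite 1 [← fromBlocks_toBlocks (fromBlocks A b c d ^ i)]
    rw [fromBlocks_multiply, toBlocks_fromBlocks₁₂, ih, Finset.sum_range_succ', Matrix.mul_sum]
    congr 1
    · refine Finset.sum_congr rfl fun k hk => ?_
      rw [Matrix.mul_smul, pow_succ', Matrix.mul_assoc]
      rw [show i + 1 - 1 - (k + 1) = i - 1 - k by omega]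
    · ext p q
      fin_cases q
      simp [Matrix.mul_apply]
      exact mul_comm _ _

theorem aux_pow21 {n : ℕ} (A : Matrix (Fin n) (Fin n) ℂ) (b : Matrix (Fin n) (Fin 1) ℂ)
    (c : Matrix (Fin 1) (Fin n) ℂ) (d : Matrix (Fin 1) (Fin 1) ℂ) (i : ℕ) :
    (fromBlocks A b c d ^ i).toBlocks₂₁ = ∑ k ∈ Finset.range i,
      ((fromBlocks A b c d ^ (i - 1 - k)).toBlocks₂₂ 0 0) • (c * A ^ k) := by
  induction i with
  | zero => ext; simp [toBlocks₂₁]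
  | succ i ih =>
    rw [pow_succ]
    nth_rewrite 1 [← fromBlocks_toBlocks (fromBlocks A b c d ^ i)]
    rw [fromBlocks_multiply, toBlocks_fromBlocks₂₁, ih, Finset.sum_range_succ', Matrix.sum_mul]
    congr 1
    · refine Finset.sum_congr rfl fun k hk => ?_
      rw [Matrix.smul_mul, pow_succ, Matrix.mul_assoc]
      rw [show i + 1 - 1 - (k + 1) = i - 1 - k by omega]
    · ext p q
      fin_cases p
      simp [Matrix.mul_apply]

theorem aux_trace_fromBlocks {n : ℕ} (A : Matrix (Fin n) (Fin n) ℂ) (b : Matrix (Fin n) (Fin 1) ℂ)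
    (c : Matrix (Fin 1) (Fin n) ℂ) (d : Matrix (Fin 1) (Fin 1) ℂ) :
    Matrix.trace (fromBlocks A b c d) = Matrix.trace A + Matrix.trace d := by
  simp [Matrix.trace, Fintype.sum_sum_type]

theorem aux_trace {n : ℕ} (A : Matrix (Fin n) (Fin n) ℂ) (b : Matrix (Fin n) (Fin 1) ℂ)
    (c : Matrix (Fin 1) (Fin n) ℂ) (d : Matrix (Fin 1) (Fin 1) ℂ) (Q : Matrix (Fin n) (Fin n) ℂ)
    (P : Matrix (Fin n ⊕ Fin 1) (Fin n ⊕ Fin 1) ℂ) :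
    Matrix.trace ((fromBlocks 1 0 0 0 * (P * fromBlocks Q 0 0 0 - fromBlocks Q 0 0 0 * P) -
      (P * fromBlocks Q 0 0 0 - fromBlocks Q 0 0 0 * P) * fromBlocks 1 0 0 0) *
        fromBlocks A b c d) =
      -(Matrix.trace (P.toBlocks₂₁ * Q * b) + Matrix.trace (c * Q * P.toBlocks₁₂)) := by
  rw [← fromBlocks_toBlocks P]
  simp only [fromBlocks_multiply, sub_eq_add_neg, fromBlocks_neg, fromBlocks_add, aux_trace_fromBlocks,
    toBlocks_fromBlocks₂₁, toBlocks_fromBlocks₁₂]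
  simp only [Matrix.mul_zero, Matrix.zero_mul, Matrix.one_mul, Matrix.mul_one, add_zero, zero_add,
    neg_zero, Matrix.neg_mul, Matrix.trace_neg, Matrix.add_mul, Matrix.trace_add, neg_add, neg_neg,
    add_neg_cancel]
  rw [Matrix.mul_assoc c, Matrix.trace_mul_comm c]
  ring

theorem aux_entry {n : ℕ} (A : Matrix (Fin n) (Fin n) ℂ) (b : Matrix (Fin n) (Fin 1) ℂ)
    (c : Matrix (Fin 1) (Fin n) ℂ) (d : Matrix (Fin 1) (Fin 1) ℂ) (i j : ℕ) :
    -(Matrix.trace ((fromBlocks A b c d ^ (i + 1)).toBlocks₂₁ * A ^ j * b) +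
      Matrix.trace (c * A ^ j * (fromBlocks A b c d ^ (i + 1)).toBlocks₁₂)) =
    -2 * ∑ k ∈ Finset.range (i + 1), ((fromBlocks A b c d ^ (i - k)).toBlocks₂₂ 0 0) *
      (c * A ^ (k + j) * b) 0 0 := by
  rw [aux_pow12, aux_pow21]
  have h1 : ∀ k, c * A ^ k * A ^ j * b = c * A ^ (k + j) * b := by
    intro k; rw [Matrix.mul_assoc c, pow_add]
  have h2 : ∀ k, c * A ^ j * (A ^ k * b) = c * A ^ (k + j) * b := by
    intro k; rw [← Matrix.mul_assoc, Matrix.mul_assoc c, add_comm, pow_add]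
  simp only [Matrix.sum_mul, Matrix.mul_sum, Matrix.smul_mul, Matrix.mul_smul, Matrix.trace_sum,
    Matrix.trace_smul, h1, h2, Matrix.trace_fin_one, smul_eq_mul, Nat.add_sub_cancel]
  ring

theorem aux_sum {n : ℕ} (A : Matrix (Fin n) (Fin n) ℂ) (b : Matrix (Fin n) (Fin 1) ℂ)
    (c : Matrix (Fin 1) (Fin n) ℂ) (d : Matrix (Fin 1) (Fin 1) ℂ) :
    (Matrix.of fun i j : Fin n =>
      -2 * ∑ k ∈ Finset.range ((i : ℕ) + 1),
        ((fromBlocks A b c d ^ ((i : ℕ) - k)).toBlocks₂₂ 0 0) * (c * A ^ (k + (j : ℕ)) * b) 0 0).det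
      = (-2) ^ n * (Matrix.of fun k j : Fin n => (c * A ^ ((k : ℕ) + j) * b) 0 0).det := by
  let W : Matrix (Fin n) (Fin n) ℂ := Matrix.of fun i k =>
    if k ≤ i then (fromBlocks A b c d ^ ((i : ℕ) - k)).toBlocks₂₂ 0 0 else 0
  have hW : W.det = 1 := by
    rw [Matrix.det_of_lowerTriangular]
    · simp [W, toBlocks₂₂]
    · intro i k h
      have : i < k := h
      simp [W, not_le.mpr this]
  have e : (Matrix.of fun i j : Fin n =>
      -2 * ∑ k ∈ Finset.range ((i : ℕ) + 1),
        ((fromBlocks A b c d ^ ((i : ℕ) - k)).toBlocks₂₂ 0 0) *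
          (c * A ^ (k + (j : ℕ)) * b) 0 0) =
      (-2 : ℂ) • (W * (Matrix.of fun k j : Fin n => (c * A ^ ((k : ℕ) + j) * b) 0 0)) := by
    ext i j
    rw [Matrix.smul_apply, Matrix.mul_apply, smul_eq_mul, Matrix.of_apply]
    congr 1
    have hi := i.2
    have : Finset.range ((i : ℕ) + 1) = (Finset.range n).filter (fun k => k ≤ (i : ℕ)) := by
      ext k; simp; omega
    rw [this, Finset.sum_filter, Finset.sum_range]
    refine Finset.sum_congr rfl fun k _ => ?_
    simp only [W, Matrix.of_apply, Fin.le_def]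
    split_ifs <;> simp
  rw [e, Matrix.det_smul, Matrix.det_mul, hW, one_mul, Fintype.card_fin]

/-- **Determinantal identity.** If `λ₁,…,λ_{n+1}` are the eigenvalues of `τ` and
`μ₁,…,μ_n, 0` those of `τ_H` (as an `(n+1) × (n+1)` matrix), counted with algebraic
multiplicity, then `det D(τ) = 2^n (-1)^{n(n-1)/2} ∏_{i,j} (λ_i - μ_j)`. -/
theorem stmt5 (n : ℕ) (τ : Matrix (Fin (n + 1)) (Fin (n + 1)) ℂ)
    (lam : Fin (n + 1) → ℂ) (μ : Fin n → ℂ)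
    (hlam : τ.charpoly = ∏ i, (X - C (lam i)))
    (hμ : (tauHmat n τ).charpoly = X * ∏ j, (X - C (μ j))) :
    (Dmat n τ).det =
      2 ^ n * (-1 : ℂ) ^ (n * (n - 1) / 2) * ∏ i, ∏ j, (lam i - μ j) := by
  let e : Fin (n + 1) ≃ Fin n ⊕ Fin 1 := finSumFinEquiv.symm
  let φ := Matrix.reindexAlgEquiv ℂ ℂ e
  have hφ : ∀ M, φ M = Matrix.reindex e e M := fun M => rfl
  have htr : ∀ M, Matrix.trace M = Matrix.trace (φ M) := by
    intro M
    simp only [hφ, Matrix.trace, Matrix.diag, Matrix.reindex_apply, Matrix.submatrix_apply]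
    exact (Equiv.sum_comp e.symm (fun i => M i i)).symm
  let A := (φ τ).toBlocks₁₁
  let b := (φ τ).toBlocks₁₂
  let c := (φ τ).toBlocks₂₁
  let d := (φ τ).toBlocks₂₂
  have hτ : φ τ = fromBlocks A b c d := (fromBlocks_toBlocks _).symm
  have hone : φ (oneHmat n) = fromBlocks 1 0 0 0 := by
    rw [hφ]
    ext i j
    rcases i with i | i <;> rcases j with j | j
    · simp [oneHmat, e, Matrix.diagonal_apply, Matrix.one_apply, Fin.ext_iff, i.2.ne]
    · simp [oneHmat, e, Matrix.diagonal_apply, Fin.ext_iff, i.2.ne]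
    · simp [oneHmat, e, Matrix.diagonal_apply, Fin.ext_iff]
    · simp [oneHmat, e, Matrix.diagonal_apply, Fin.ext_iff]
  have htH : φ (tauHmat n τ) = fromBlocks A 0 0 0 := by
    rw [tauHmat, map_mul, map_mul, hone, hτ]
    simp [fromBlocks_multiply]
  have hpow : ∀ j : ℕ, φ (oneHmat n * tauHmat n τ ^ j) = fromBlocks (A ^ j) 0 0 0 := by
    intro j
    induction j with
    | zero => simp [hone]
    | succ j ih =>
      rw [pow_succ, ← mul_assoc, map_mul, ih, htH]
      simp [fromBlocks_multiply, pow_succ]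
  have hlam' : (fromBlocks A b c d).charpoly = ∏ i, (X - C (lam i)) := by
    rw [← hτ, hφ, Matrix.charpoly_reindex, hlam]
  have hμ' : A.charpoly = ∏ j, (X - C (μ j)) := by
    have h : (φ (tauHmat n τ)).charpoly = X * ∏ j, (X - C (μ j)) := by
      rw [hφ, Matrix.charpoly_reindex, hμ]
    rw [htH, charpoly_fromBlocks_zero₁₂, Matrix.charpoly_zero] at h
    simp only [Fintype.card_fin, pow_one] at h
    rw [mul_comm] at h
    exact mul_left_cancel₀ X_ne_zero h
  have hD : Dmat n τ = Matrix.of fun i j : Fin n =>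
      -2 * ∑ k ∈ Finset.range ((i : ℕ) + 1),
        ((fromBlocks A b c d ^ ((i : ℕ) - k)).toBlocks₂₂ 0 0) *
          (c * A ^ (k + (j : ℕ)) * b) 0 0 := by
    ext i j
    rw [Dmat, Matrix.of_apply, Matrix.of_apply, htr, ← aux_entry, ← aux_trace A b c d]
    simp only [map_mul φ _ τ, map_sub, map_mul φ (oneHmat n) (_ - _), map_mul φ (_ - _) (oneHmat n),
      map_mul φ (τ ^ _) _, map_mul φ _ (τ ^ _), hpow, hone, map_pow, hτ]
  have hH := aux_hankel A b c d lam μ hlam' hμ'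
  rw [hD, aux_sum]
  have hs : ((-1 : ℂ) ^ (n * (n - 1) / 2)) * (-1 : ℂ) ^ (n * (n - 1) / 2) = 1 := by
    rw [← mul_pow]; simp
  have hs2 : ((-1 : ℂ) ^ n) * (-1 : ℂ) ^ n = 1 := by
    rw [← mul_pow]; simp
  have h2 : (-2 : ℂ) ^ n = 2 ^ n * (-1) ^ n := by
    rw [← mul_pow]; norm_num
  generalize (Matrix.of fun k j : Fin n => (c * A ^ ((k : ℕ) + j) * b) 0 0).det = Hd at *
  generalize (∏ i, ∏ j, (lam i - μ j)) = R at *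
  generalize ((-1 : ℂ) ^ (n * (n - 1) / 2)) = s at *
  have : Hd = s * ((-1) ^ n * R) := by rw [← hH, ← mul_assoc, hs, one_mul]
  rw [this, h2]
  linear_combination (2 ^ n * s * R) * hs2
end

section
/- Let $V_1, V_2$ be Hilbert spaces and $T_j : V_1 \to V_2$ a sequence of bounded operators satisfying $\sup_j \sum_k \|T_j^* T_k\|^{1/2} \le C$ and $\sup_j \sum_k \|T_j T_k^*\|^{1/2} \le C$. Then the series $T = \sum_j T_j$ converges in the strong operator topology to a bounded operator with $\|T\| \le C$ (Cotlar–Stein lemma). -/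
open ContinuousLinearMap

section CotlarStein

variable {V₁ V₂ : Type*}
    [NormedAddCommGroup V₁] [InnerProductSpace ℂ V₁] [CompleteSpace V₁]
    [NormedAddCommGroup V₂] [InnerProductSpace ℂ V₂] [CompleteSpace V₂]

/-- The norm of a single operator is at most `C`. -/
lemma cs_norm_le (T : ℕ → V₁ →L[ℂ] V₂) (C : ℝ)
    (hsum₁ : ∀ j, Summable fun k => Real.sqrt ‖adjoint (T j) ∘L T k‖)
    (h₁ : ∀ j, (∑' k, Real.sqrt ‖adjoint (T j) ∘L T k‖) ≤ C) (j : ℕ) : ‖T j‖ ≤ C := by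
  have h := (hsum₁ j).le_tsum j (fun _ _ => Real.sqrt_nonneg _)
  rw [ContinuousLinearMap.norm_adjoint_comp_self, Real.sqrt_mul_self (norm_nonneg _)] at h
  exact h.trans (h₁ j)

lemma cs_step (T : ℕ → V₁ →L[ℂ] V₂) (X : V₁ →L[ℂ] V₁) (j k l : ℕ) :
    Real.sqrt (‖X ∘L adjoint (T j) ∘L T k‖ * ‖(X ∘L adjoint (T j) ∘L T k) ∘L adjoint (T l)‖)
      ≤ Real.sqrt (‖X‖ * ‖X ∘L adjoint (T j)‖) * (Real.sqrt ‖adjoint (T j) ∘L T k‖ *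
        Real.sqrt ‖T k ∘L adjoint (T l)‖) := by
  rw [← Real.sqrt_mul (norm_nonneg _), ← Real.sqrt_mul (by positivity)]
  apply Real.sqrt_le_sqrt
  have e1 : ‖X ∘L adjoint (T j) ∘L T k‖ ≤ ‖X‖ * ‖adjoint (T j) ∘L T k‖ := opNorm_comp_le _ _
  have e2 : ‖(X ∘L adjoint (T j) ∘L T k) ∘L adjoint (T l)‖ ≤
      ‖X ∘L adjoint (T j)‖ * ‖T k ∘L adjoint (T l)‖ := 
    opNorm_comp_le (X ∘L adjoint (T j)) (T k ∘L adjoint (T l))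
  calc _ ≤ (‖X‖ * ‖adjoint (T j) ∘L T k‖) * (‖X ∘L adjoint (T j)‖ * ‖T k ∘L adjoint (T l)‖) := by
        gcongr
    _ = _ := by ring

lemma cs_ind (T : ℕ → V₁ →L[ℂ] V₂) (C : ℝ)
    (hsum₁ : ∀ j, Summable fun k => Real.sqrt ‖adjoint (T j) ∘L T k‖)
    (h₁ : ∀ j, (∑' k, Real.sqrt ‖adjoint (T j) ∘L T k‖) ≤ C)
    (hsum₂ : ∀ j, Summable fun k => Real.sqrt ‖T j ∘L adjoint (T k)‖)
    (h₂ : ∀ j, (∑' k, Real.sqrt ‖T j ∘L adjoint (T k)‖) ≤ C) (F : Finset ℕ) (n : ℕ) :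
    ∀ (X : V₁ →L[ℂ] V₁) (j : ℕ),
      ‖(X ∘L adjoint (T j)) ∘L (((∑ k ∈ F, T k) ∘L adjoint (∑ k ∈ F, T k)) ^ n : V₂ →L[ℂ] V₂)‖
        ≤ Real.sqrt C * (C ^ 2) ^ n * Real.sqrt (‖X‖ * ‖X ∘L adjoint (T j)‖) := by
  have hC : 0 ≤ C := (norm_nonneg _).trans (cs_norm_le T C hsum₁ h₁ 0)
  induction n with
  | zero =>
    intro X j
    have e : (X ∘L adjoint (T j)) ∘L
        (((∑ k ∈ F, T k) ∘L adjoint (∑ k ∈ F, T k)) ^ 0 : V₂ →L[ℂ] V₂) = X ∘L adjoint (T j) := by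
      ext v; simp
    rw [e, pow_zero, mul_one, ← Real.sqrt_mul hC]
    apply Real.le_sqrt_of_sq_le
    have hb : ‖X ∘L adjoint (T j)‖ ≤ ‖X‖ * C := by
      refine (opNorm_comp_le _ _).trans ?_
      gcongr
      rw [LinearIsometryEquiv.norm_map]
      exact cs_norm_le T C hsum₁ h₁ j
    nlinarith [norm_nonneg (X ∘L adjoint (T j))]
  | succ n ih =>
    intro X j
    set D : V₂ →L[ℂ] V₂ := (∑ k ∈ F, T k) ∘L adjoint (∑ k ∈ F, T k) with hD
    have e : (X ∘L adjoint (T j)) ∘L (D ^ (n + 1)) =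
        ∑ k ∈ F, ∑ l ∈ F, ((X ∘L adjoint (T j) ∘L T k) ∘L adjoint (T l)) ∘L (D ^ n) := by
      ext v
      rw [pow_succ']
      simp [hD, map_sum]
      exact Finset.sum_comm
    rw [e]
    have hs1 : ∑ k ∈ F, Real.sqrt ‖adjoint (T j) ∘L T k‖ ≤ C :=
      ((hsum₁ j).sum_le_tsum F (fun _ _ => Real.sqrt_nonneg _)).trans (h₁ j)
    have hs2 : ∀ k, ∑ l ∈ F, Real.sqrt ‖T k ∘L adjoint (T l)‖ ≤ C := fun k =>
      ((hsum₂ k).sum_le_tsum F (fun _ _ => Real.sqrt_nonneg _)).trans (h₂ k)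
    set m := Real.sqrt (‖X‖ * ‖X ∘L adjoint (T j)‖)
    calc _ ≤ ∑ k ∈ F, ∑ l ∈ F, Real.sqrt C * (C ^ 2) ^ n * (m *
          (Real.sqrt ‖adjoint (T j) ∘L T k‖ * Real.sqrt ‖T k ∘L adjoint (T l)‖)) := by
          refine norm_sum_le_of_le _ fun k _ => norm_sum_le_of_le _ fun l _ => ?_
          refine (ih _ _).trans ?_
          gcongr
          exact cs_step T X j k l
      _ = Real.sqrt C * (C ^ 2) ^ n * m * ∑ k ∈ F, (Real.sqrt ‖adjoint (T j) ∘L T k‖ *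
            ∑ l ∈ F, Real.sqrt ‖T k ∘L adjoint (T l)‖) := by
          simp only [Finset.mul_sum]
          refine Finset.sum_congr rfl fun k _ => Finset.sum_congr rfl fun l _ => ?_
          ring
      _ ≤ Real.sqrt C * (C ^ 2) ^ n * m * ∑ k ∈ F, (Real.sqrt ‖adjoint (T j) ∘L T k‖ * C) := by
          gcongr with k _
          exact hs2 k
      _ ≤ Real.sqrt C * (C ^ 2) ^ n * m * (C * C) := by
          rw [← Finset.sum_mul]
          gcongr
      _ = _ := by ring

lemma cs_finite (T : ℕ → V₁ →L[ℂ] V₂) (C : ℝ)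
    (hsum₁ : ∀ j, Summable fun k => Real.sqrt ‖adjoint (T j) ∘L T k‖)
    (h₁ : ∀ j, (∑' k, Real.sqrt ‖adjoint (T j) ∘L T k‖) ≤ C)
    (hsum₂ : ∀ j, Summable fun k => Real.sqrt ‖T j ∘L adjoint (T k)‖)
    (h₂ : ∀ j, (∑' k, Real.sqrt ‖T j ∘L adjoint (T k)‖) ≤ C) (F : Finset ℕ) :
    ‖∑ k ∈ F, T k‖ ≤ C := by
  have hC : 0 ≤ C := (norm_nonneg _).trans (cs_norm_le T C hsum₁ h₁ 0)
  have key := cs_ind T C hsum₁ h₁ hsum₂ h₂ F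
  have hA : adjoint (∑ k ∈ F, T k) = ∑ k ∈ F, adjoint (T k) := map_sum _ _ _
  set A := ∑ k ∈ F, T k with hAdef
  set D : V₂ →L[ℂ] V₂ := A ∘L adjoint A with hD
  have hDsa : IsSelfAdjoint D := by
    rw [ContinuousLinearMap.isSelfAdjoint_iff', hD, adjoint_comp, adjoint_adjoint]
  have hDn : ‖D‖ = ‖A‖ * ‖A‖ := by
    have := ContinuousLinearMap.norm_adjoint_comp_self (adjoint A)
    rwa [adjoint_adjoint, LinearIsometryEquiv.norm_map] at this
  have hb : ∀ n : ℕ, ‖D ^ (n + 1)‖ ≤ (‖A‖ * (F.card * C)) * (C ^ 2) ^ n := by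
    intro n
    have e : D ^ (n + 1) = A ∘L (∑ j ∈ F,
        ((ContinuousLinearMap.id ℂ V₁) ∘L adjoint (T j)) ∘L (D ^ n)) := by
      ext v
      rw [pow_succ']
      simp [hD, hA]
    rw [e, mul_assoc]
    refine (opNorm_comp_le _ _).trans ?_
    gcongr
    have : ∀ j ∈ F, ‖((ContinuousLinearMap.id ℂ V₁) ∘L adjoint (T j)) ∘L (D ^ n)‖ ≤
        C * (C ^ 2) ^ n := by
      intro j _
      refine (key n _ j).trans ?_
      have : Real.sqrt (‖ContinuousLinearMap.id ℂ V₁‖ *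
          ‖(ContinuousLinearMap.id ℂ V₁) ∘L adjoint (T j)‖) ≤ Real.sqrt C := by
        apply Real.sqrt_le_sqrt
        rw [ContinuousLinearMap.id_comp, LinearIsometryEquiv.norm_map]
        calc _ ≤ 1 * C := by
              gcongr
              · exact ContinuousLinearMap.norm_id_le
              · exact cs_norm_le T C hsum₁ h₁ j
          _ = C := one_mul C
      calc _ ≤ Real.sqrt C * (C ^ 2) ^ n * Real.sqrt C := by gcongr
        _ = (Real.sqrt C * Real.sqrt C) * (C ^ 2) ^ n := by ring
        _ = _ := by rw [Real.mul_self_sqrt hC]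
    refine (norm_sum_le_of_le _ this).trans ?_
    rw [Finset.sum_const, nsmul_eq_mul, mul_assoc]
  by_contra hcon
  push Not at hcon
  have hr : C ^ 2 < ‖D‖ := by rw [hDn]; nlinarith
  have hr0 : 0 < ‖D‖ := lt_of_le_of_lt (by positivity) hr
  set K := ‖A‖ * (F.card * C) with hK
  have hb2 : ∀ n : ℕ, ‖D‖ ≤ K * (C ^ 2 / ‖D‖) ^ (2 ^ n - 1) := by
    intro n
    have h := hb (2 ^ n - 1)
    have h2 : 2 ^ n - 1 + 1 = 2 ^ n := Nat.sub_add_cancel Nat.one_le_two_pow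
    have h3 : ‖D ^ (2 ^ n)‖ = ‖D‖ ^ (2 ^ n) := by
      have := hDsa.nnnorm_pow_two_pow n
      simpa only [NNReal.coe_pow, coe_nnnorm] using congrArg NNReal.toReal this
    rw [h2, h3, ← h2, pow_succ, h2] at h
    rw [div_pow, ← mul_div_assoc, le_div_iff₀ (by positivity)]
    linarith
  have hlim : Filter.Tendsto (fun n : ℕ => K * (C ^ 2 / ‖D‖) ^ (2 ^ n - 1)) Filter.atTop
      (nhds (K * 0)) := by
    refine Filter.Tendsto.const_mul _ ?_
    refine (tendsto_pow_atTop_nhds_zero_of_lt_one (by positivity)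
      ((div_lt_one hr0).2 hr)).comp ?_
    refine Filter.tendsto_atTop_mono (f := fun n => n) (fun n => ?_) Filter.tendsto_id
    have := Nat.lt_two_pow_self (n := n)
    omega
  have := ge_of_tendsto' hlim hb2
  linarith

end CotlarStein

/-- **Cotlar–Stein lemma.**  If `T_j : V₁ → V₂` are bounded operators between Hilbert
spaces with `sup_j ∑_k ‖T_j* T_k‖^{1/2} ≤ C` and `sup_j ∑_k ‖T_j T_k*‖^{1/2} ≤ C`, then
`∑_j T_j` converges in the strong operator topology to a bounded operator of norm `≤ C`. -/
theorem stmt15 (V₁ V₂ : Type*)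
    [NormedAddCommGroup V₁] [InnerProductSpace ℂ V₁] [CompleteSpace V₁]
    [NormedAddCommGroup V₂] [InnerProductSpace ℂ V₂] [CompleteSpace V₂]
    (T : ℕ → V₁ →L[ℂ] V₂) (C : ℝ)
    (hsum₁ : ∀ j, Summable fun k => Real.sqrt ‖adjoint (T j) ∘L T k‖)
    (h₁ : ∀ j, (∑' k, Real.sqrt ‖adjoint (T j) ∘L T k‖) ≤ C)
    (hsum₂ : ∀ j, Summable fun k => Real.sqrt ‖T j ∘L adjoint (T k)‖)
    (h₂ : ∀ j, (∑' k, Real.sqrt ‖T j ∘L adjoint (T k)‖) ≤ C) :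
    ∃ S : V₁ →L[ℂ] V₂, ‖S‖ ≤ C ∧ ∀ v : V₁, HasSum (fun j => T j v) (S v) := by
  have hC : 0 ≤ C := (norm_nonneg _).trans (cs_norm_le T C hsum₁ h₁ 0)
  have hF : ∀ (F : Finset ℕ) (v : V₁), ‖∑ k ∈ F, T k v‖ ≤ C * ‖v‖ := by
    intro F v
    rw [← ContinuousLinearMap.sum_apply]
    exact le_of_opNorm_le _ (cs_finite T C hsum₁ h₁ hsum₂ h₂ F) v
  let E : Submodule ℂ V₁ :=
    { carrier := {v | Summable fun j => T j v}
      add_mem' := by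
        intro a b ha hb
        simp only [Set.mem_setOf_eq, map_add] at *
        exact ha.add hb
      zero_mem' := by simp [summable_zero]
      smul_mem' := by
        intro c a ha
        simp only [Set.mem_setOf_eq, map_smul] at *
        exact ha.const_smul c }
  have hE : ∀ v, v ∈ E ↔ Summable fun j => T j v := fun v => Iff.rfl
  have hclosed : IsClosed (E : Set V₁) := by
    refine isClosed_of_closure_subset fun v hv => ?_
    show Summable fun j => T j v
    rw [summable_iff_vanishing_norm]
    intro ε hε
    obtain ⟨u, hu, huv⟩ := Metric.mem_closure_iff.1 hv (ε / (2 * (C + 1))) (by positivity)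
    obtain ⟨s, hs⟩ := summable_iff_vanishing_norm.1 ((hE u).1 hu) (ε / 2) (by positivity)
    refine ⟨s, fun t ht => ?_⟩
    have e : ∑ i ∈ t, T i v = ∑ i ∈ t, T i u + ∑ i ∈ t, T i (v - u) := by
      rw [← Finset.sum_add_distrib]
      exact Finset.sum_congr rfl fun i _ => by rw [map_sub]; abel
    have h3 := hF t (v - u)
    rw [dist_eq_norm, lt_div_iff₀ (by positivity)] at huv
    rw [e]
    have h4 := norm_add_le (∑ i ∈ t, T i u) (∑ i ∈ t, T i (v - u))
    have h5 := hs t ht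
    nlinarith [norm_nonneg (v - u)]
  have hrange : ∀ k w, adjoint (T k) w ∈ E := by
    intro k w
    rw [hE]
    have hs : Summable fun j => ‖T k ∘L adjoint (T j)‖ := by
      refine Summable.of_nonneg_of_le (fun _ => norm_nonneg _) (fun j => ?_) ((hsum₂ k).mul_left C)
      have := ((hsum₂ k).le_tsum j (fun _ _ => Real.sqrt_nonneg _)).trans (h₂ k)
      calc _ = Real.sqrt ‖T k ∘L adjoint (T j)‖ * Real.sqrt ‖T k ∘L adjoint (T j)‖ :=
            (Real.mul_self_sqrt (norm_nonneg _)).symm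
        _ ≤ _ := by gcongr
    refine Summable.of_norm_bounded (hs.mul_right ‖w‖) fun j => ?_
    have e : ‖T k ∘L adjoint (T j)‖ = ‖T j ∘L adjoint (T k)‖ := by
      rw [← LinearIsometryEquiv.norm_map adjoint (T k ∘L adjoint (T j)), adjoint_comp,
        adjoint_adjoint]
    rw [e]
    exact (T j ∘L adjoint (T k)).le_opNorm w
  have hperp : Eᗮ ≤ E := by
    intro v hv
    rw [hE]
    have : ∀ j, T j v = 0 := by
      intro j
      have h := (Submodule.mem_orthogonal E v).1 hv _ (hrange j (T j v))
      rw [adjoint_inner_left] at h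
      exact inner_self_eq_zero.1 h
    simp [this, summable_zero]
  have hbot : Eᗮ = ⊥ := by
    rw [eq_bot_iff]
    intro v hv
    have := (Submodule.mem_orthogonal E v).1 hv v (hperp hv)
    exact inner_self_eq_zero.1 this
  haveI : CompleteSpace E := hclosed.completeSpace_coe
  have htop : E = ⊤ := (Submodule.orthogonal_eq_bot_iff).1 hbot
  have hsm : ∀ v, Summable fun j => T j v := fun v => (hE v).1 (htop ▸ Submodule.mem_top)
  let S₀ : V₁ →ₗ[ℂ] V₂ :=
    { toFun := fun v => ∑' j, T j v
      map_add' := by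
        intro a b
        simp only [map_add]
        exact (hsm a).tsum_add (hsm b)
      map_smul' := by
        intro c a
        simp only [map_smul, RingHom.id_apply]
        exact (hsm a).tsum_const_smul c }
  refine ⟨S₀.mkContinuous C fun v => ?_, LinearMap.mkContinuous_norm_le _ hC _,
    fun v => (hsm v).hasSum⟩
  exact le_of_tendsto' (hsm v).hasSum.norm fun F => hF F v
end
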